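/- Let n ≥ 1 and let u : ℝⁿ → ℝⁿ be a Schwartz vector field. There exist a constant c > 0 (depending only on n and φ) and a nonnegative sequence (d_k)_{k∈ℤ} with Σ_{k∈ℤ} d_k = 1 such that for every k ∈ ℤ and every component index l, ‖Σ_{j∈ℤ} Σᵢ (Ṡ_{j−1}uᵢ − Ṡ_{k−1}uᵢ)·∂ᵢ(Δ_k Δ_j u_l)‖_{L²} ≤ c·d_k·2^{−k(n/2+1)}·‖u‖²_{Ḃ^{n/2+1}_{2,1}}. (Only the terms j = k−1, k, k+1 contribute, since Δ_kΔ_j = 0 for |j−k| ≥ 2 and Ṡ_{j−1} − Ṡ_{k−1} = 0 for j = k.) -/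

import Mathlib

open MeasureTheory Filter SchwartzMap
open scoped FourierTransform

noncomputable section

abbrev Ell (n : ℕ) := EuclideanSpace ℝ (Fin n)

def eVec (n : ℕ) (i : Fin n) : Ell n := EuclideanSpace.single i 1

/-- coercion of a real-valued function to a complex-valued one -/
def cf {n : ℕ} (f : Ell n → ℝ) : Ell n → ℂ := fun x => (f x : ℂ)

/-- the Fourier multiplier operator `Λ^s` with symbol `|ξ|^s` -/
def Lam {n : ℕ} (s : ℝ) (f : Ell n → ℂ) : Ell n → ℂ :=
  𝓕⁻ (fun ξ => ((‖ξ‖ ^ s : ℝ) : ℂ) * 𝓕 f ξ)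

/-- the partial derivative `∂ᵢ` -/
def pd {n : ℕ} (i : Fin n) (f : Ell n → ℂ) : Ell n → ℂ :=
  fun x => fderiv ℝ f x (eVec n i)

/-- the advection term `(v·∇)w` for complex vector fields -/
def adv {n : ℕ} (v w : Fin n → Ell n → ℂ) : Fin n → Ell n → ℂ :=
  fun l x => ∑ i, v i x * pd i (w l) x

/-- squared homogeneous Sobolev norm of a complex scalar function -/
def HsqC {n : ℕ} (s : ℝ) (f : Ell n → ℂ) : ℝ :=
  ∫ ξ, ‖ξ‖ ^ (2 * s) * ‖𝓕 f ξ‖ ^ 2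

/-- homogeneous Sobolev norm `‖u‖_{Ḣ^s}` of a real vector field -/
def Hnorm {n : ℕ} (s : ℝ) (u : Fin n → Ell n → ℝ) : ℝ :=
  Real.sqrt (∑ l, HsqC s (cf (u l)))

/-- `L²` norm of a complex vector field -/
def vL2 {n : ℕ} (f : Fin n → Ell n → ℂ) : ℝ :=
  Real.sqrt (∑ l, ∫ x, ‖f l x‖ ^ 2)

/-- `L²` pairing `⟨f,g⟩ = Σ_l ∫ f_l g_l` of complex vector fields -/
def Cinner {n : ℕ} (f g : Fin n → Ell n → ℂ) : ℂ :=
  ∑ l, ∫ x, f l x * g l x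

/-- The standing assumptions on the Littlewood–Paley function `φ`: a smooth,
radial, compactly supported function with values in `[0,1]`, supported in the
annulus `{3/4 ≤ |ξ| ≤ 8/3}`, with `Σ_{j∈ℤ} φ(2^{−j}ξ) = 1` for `ξ ≠ 0` and
`φ(2^{−j}·), φ(2^{−j'}·)` having disjoint supports when `|j−j'| ≥ 2`. -/
def LPFunction {n : ℕ} (φ : Ell n → ℝ) : Prop :=
  ContDiff ℝ (⊤ : ℕ∞) φ ∧ HasCompactSupport φ ∧
  (∀ ξ, φ ξ ≠ 0 → 3 / 4 ≤ ‖ξ‖ ∧ ‖ξ‖ ≤ 8 / 3) ∧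
  (∀ ξ, φ ξ ∈ Set.Icc (0 : ℝ) 1) ∧
  (∀ ξ η : Ell n, ‖ξ‖ = ‖η‖ → φ ξ = φ η) ∧
  (∀ ξ : Ell n, ξ ≠ 0 → (∑' j : ℤ, φ ((2 : ℝ) ^ (-j) • ξ)) = 1) ∧
  (∀ j j' : ℤ, 2 ≤ |j - j'| → ∀ ξ : Ell n,
    φ ((2 : ℝ) ^ (-j) • ξ) * φ ((2 : ℝ) ^ (-j') • ξ) = 0)

/-- the homogeneous dyadic block `Δ_j u = 𝓕⁻¹(φ(2^{−j}ξ) û(ξ))` -/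
def DeltaJ {n : ℕ} (φ : Ell n → ℝ) (j : ℤ) (f : Ell n → ℂ) : Ell n → ℂ :=
  𝓕⁻ (fun ξ => ((φ ((2 : ℝ) ^ (-j) • ξ) : ℝ) : ℂ) * 𝓕 f ξ)

/-- the homogeneous cutoff `Ṡ_j u = Σ_{j' ≤ j−1} Δ_{j'} u` -/
def SJ {n : ℕ} (φ : Ell n → ℝ) (j : ℤ) (f : Ell n → ℂ) : Ell n → ℂ :=
  fun x => ∑' j' : ℤ, if j' ≤ j - 1 then DeltaJ φ j' f x else 0

/-- `L²` norm of `Δ_j u` for a real vector field `u` -/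
def DeltaL2 {n : ℕ} (φ : Ell n → ℝ) (j : ℤ) (u : Fin n → Ell n → ℝ) : ℝ :=
  Real.sqrt (∑ l, ∫ x, ‖DeltaJ φ j (cf (u l)) x‖ ^ 2)

/-- the homogeneous Besov norm `‖u‖_{Ḃ^s_{2,1}} = Σ_{j∈ℤ} 2^{js} ‖Δ_j u‖_{L²}` -/
def Bnorm {n : ℕ} (φ : Ell n → ℝ) (s : ℝ) (u : Fin n → Ell n → ℝ) : ℝ :=
  ∑' j : ℤ, (2 : ℝ) ^ ((j : ℝ) * s) * DeltaL2 φ j u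

section LittlewoodPaley

open Real

variable {n : ℕ} {φ : Ell n → ℝ}

/-- The symbol `φ(2^{−j}ξ)` of the dyadic block `Δ_j`. -/
def blockSymbol (φ : Ell n → ℝ) (j : ℤ) : Ell n → ℂ :=
  fun ξ => ((φ ((2 : ℝ) ^ (-j) • ξ) : ℝ) : ℂ)

/-- The dyadic block `Δ_j` as an operator on Schwartz functions. -/
def block (φ : Ell n → ℝ) (j : ℤ) : 𝓢(Ell n, ℂ) →L[ℂ] 𝓢(Ell n, ℂ) :=
  fourierMultiplierCLM ℂ (blockSymbol φ j)

/-- The `L²` norm of a Schwartz function. -/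
def sL2 (F : 𝓢(Ell n, ℂ)) : ℝ := √(∫ x, ‖F x‖ ^ 2)

/-- A real Schwartz function viewed as a complex one. -/
def toComplex (f : 𝓢(Ell n, ℝ)) : 𝓢(Ell n, ℂ) := f.postcompCLM Complex.ofRealCLM

lemma coe_toComplex (f : 𝓢(Ell n, ℝ)) : ⇑(toComplex f) = cf f := rfl

lemma blockSymbol_hasTemperateGrowth (hφ : LPFunction φ) (j : ℤ) :
    (blockSymbol φ j).HasTemperateGrowth := by
  have h1 : φ.HasTemperateGrowth := hφ.2.1.hasTemperateGrowth hφ.1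
  have h2 : (fun ξ : Ell n => φ ((2 : ℝ) ^ (-j) • ξ)).HasTemperateGrowth :=
    h1.comp (((2 : ℝ) ^ (-j)) • ContinuousLinearMap.id ℝ (Ell n)).hasTemperateGrowth
  exact Complex.ofRealCLM.hasTemperateGrowth.comp h2

lemma norm_blockSymbol_le_one (hφ : LPFunction φ) (j : ℤ) (ξ : Ell n) :
    ‖blockSymbol φ j ξ‖ ≤ 1 := by
  have h := hφ.2.2.2.1 ((2 : ℝ) ^ (-j) • ξ)
  rw [blockSymbol, Complex.norm_real, Real.norm_eq_abs, abs_of_nonneg h.1]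
  exact h.2

lemma norm_bounds_of_blockSymbol_ne_zero (hφ : LPFunction φ) {j : ℤ} {ξ : Ell n}
    (h : blockSymbol φ j ξ ≠ 0) : 3 / 4 * (2 : ℝ) ^ j ≤ ‖ξ‖ ∧ ‖ξ‖ ≤ 8 / 3 * (2 : ℝ) ^ j := by
  have h' := hφ.2.2.1 ((2 : ℝ) ^ (-j) • ξ) (by simpa [blockSymbol] using h)
  have hpos : (0 : ℝ) < (2 : ℝ) ^ j := by positivity
  rw [norm_smul, Real.norm_eq_abs, abs_of_pos (by positivity), zpow_neg, inv_mul_eq_div,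
    le_div_iff₀ hpos, div_le_iff₀ hpos] at h'
  exact h'

lemma fourier_block (hφ : LPFunction φ) (j : ℤ) (F : 𝓢(Ell n, ℂ)) (ξ : Ell n) :
    𝓕 (block φ j F) ξ = blockSymbol φ j ξ * 𝓕 F ξ := by
  rw [block, fourierMultiplierCLM_apply, FourierTransform.fourier_fourierInv_eq,
    smulLeftCLM_apply_apply (blockSymbol_hasTemperateGrowth hφ j), smul_eq_mul]

lemma DeltaJ_coe (hφ : LPFunction φ) (j : ℤ) (F : 𝓢(Ell n, ℂ)) :
    DeltaJ φ j F = block φ j F := by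
  rw [block, fourierMultiplierCLM_apply, fourierInv_coe, DeltaJ]
  congr 1
  ext ξ
  rw [smulLeftCLM_apply_apply (blockSymbol_hasTemperateGrowth hφ j), smul_eq_mul, fourier_coe]
  rfl

lemma block_block_eq_zero (hφ : LPFunction φ) {j k : ℤ} (h : 2 ≤ |k - j|) (F : 𝓢(Ell n, ℂ)) :
    block φ k (block φ j F) = 0 := by
  have : 𝓕 (block φ k (block φ j F)) = 0 := by
    ext ξ
    rw [fourier_block hφ, fourier_block hφ, ← mul_assoc]
    rw [blockSymbol, blockSymbol, ← Complex.ofReal_mul, hφ.2.2.2.2.2.2 k j h ξ]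
    simp
  have hinv : block φ k (block φ j F) = 𝓕⁻ (𝓕 (block φ k (block φ j F))) :=
    (FourierTransform.fourierInv_fourier_eq _).symm
  rw [hinv, this]
  exact map_zero (FourierTransform.fourierInvCLM ℂ 𝓢(Ell n, ℂ))

lemma integrable_norm_sq (F : 𝓢(Ell n, ℂ)) : Integrable (fun x => ‖F x‖ ^ 2) :=
  (F.memLp 2).integrable_norm_pow (by norm_num)

lemma integrable_pow_mul_norm_sq (F : 𝓢(Ell n, ℂ)) (N : ℕ) :
    Integrable (fun x => (‖x‖ ^ N * ‖F x‖) ^ 2) := by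
  refine ((F.integrable_pow_mul volume (2 * N)).mul_const (SchwartzMap.seminorm ℝ 0 0 F)).mono
    (by fun_prop) (Eventually.of_forall fun x => ?_)
  have h := SchwartzMap.norm_le_seminorm ℝ F x
  rw [Real.norm_of_nonneg (by positivity), Real.norm_of_nonneg (by positivity)]
  calc (‖x‖ ^ N * ‖F x‖) ^ 2 = ‖x‖ ^ (2 * N) * ‖F x‖ * ‖F x‖ := by ring
    _ ≤ _ := by gcongr

lemma sL2_nonneg (F : 𝓢(Ell n, ℂ)) : 0 ≤ sL2 F := Real.sqrt_nonneg _

lemma sL2_sq (F : 𝓢(Ell n, ℂ)) : sL2 F ^ 2 = ∫ x, ‖F x‖ ^ 2 :=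
  Real.sq_sqrt (integral_nonneg fun _ => by positivity)

lemma sL2_block_le (hφ : LPFunction φ) (N : ℕ) (F : 𝓢(Ell n, ℂ)) (j : ℤ) :
    sL2 (block φ j F) ≤
      (4 / 3) ^ N * √(∫ ξ, (‖ξ‖ ^ N * ‖𝓕 F ξ‖) ^ 2) * ((2 : ℝ) ^ (-j)) ^ N := by
  have hI : 0 ≤ ∫ ξ, (‖ξ‖ ^ N * ‖𝓕 F ξ‖) ^ 2 := integral_nonneg fun _ => by positivity
  refine Real.sqrt_le_iff.2 ⟨by positivity, ?_⟩
  rw [← integral_norm_sq_fourier, mul_pow, mul_pow, Real.sq_sqrt hI, mul_right_comm,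
    ← integral_const_mul]
  refine integral_mono (integrable_norm_sq _) ((integrable_pow_mul_norm_sq _ N).const_mul _)
    fun ξ => ?_
  simp only [fourier_block hφ]
  by_cases h : blockSymbol φ j ξ = 0
  · rw [h, zero_mul, norm_zero, zero_pow two_ne_zero]; positivity
  have h1 : 1 ≤ 4 / 3 * (2 : ℝ) ^ (-j) * ‖ξ‖ := by
    have := (norm_bounds_of_blockSymbol_ne_zero hφ h).1
    have hpos : (0 : ℝ) < (2 : ℝ) ^ j := by positivity
    rw [zpow_neg, ← div_eq_mul_inv, div_mul_eq_mul_div, le_div_iff₀ hpos]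
    linarith
  rw [norm_mul, ← mul_pow, ← mul_pow]
  refine pow_le_pow_left₀ (by positivity) ?_ 2
  calc ‖blockSymbol φ j ξ‖ * ‖𝓕 F ξ‖ ≤ (4 / 3 * (2 : ℝ) ^ (-j) * ‖ξ‖) ^ N * ‖𝓕 F ξ‖ := by
        gcongr
        exact (norm_blockSymbol_le_one hφ j ξ).trans (one_le_pow₀ h1)
    _ = _ := by ring

lemma summable_rpow_mul_sL2_block (hφ : LPFunction φ) {s : ℝ} (hs : 0 < s) (F : 𝓢(Ell n, ℂ)) :
    Summable fun j : ℤ => (2 : ℝ) ^ ((j : ℝ) * s) * sL2 (block φ j F) := by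
  obtain ⟨N, hN⟩ := exists_nat_gt s
  refine Summable.of_nat_of_neg ?_ ?_
  · refine Summable.of_nonneg_of_le (fun j => mul_nonneg (by positivity) (sL2_nonneg _))
      (fun j => mul_le_mul_of_nonneg_left (sL2_block_le hφ N F _) (by positivity)) ?_
    have hr : (2 : ℝ) ^ (s - N) < 1 :=
      Real.rpow_lt_one_of_one_lt_of_neg (by norm_num) (by linarith)
    refine ((summable_geometric_of_lt_one (by positivity) hr).mul_left
      ((4 / 3) ^ N * √(∫ ξ, (‖ξ‖ ^ N * ‖𝓕 F ξ‖) ^ 2))).congr fun j => ?_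
    rw [← Real.rpow_natCast (2 ^ (s - N)), ← Real.rpow_mul (by norm_num), ← Real.rpow_intCast,
      ← Real.rpow_natCast (2 ^ _) N, ← Real.rpow_mul (by norm_num), mul_left_comm,
      ← Real.rpow_add (by norm_num)]
    push_cast
    ring_nf
  · refine Summable.of_nonneg_of_le (fun j => mul_nonneg (by positivity) (sL2_nonneg _))
      (fun j => mul_le_mul_of_nonneg_left (sL2_block_le hφ 0 F _) (by positivity)) ?_
    have hr : (2 : ℝ) ^ (-s) < 1 :=
      Real.rpow_lt_one_of_one_lt_of_neg (by norm_num) (by linarith)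
    refine ((summable_geometric_of_lt_one (by positivity) hr).mul_left
      ((4 / 3) ^ 0 * √(∫ ξ, (‖ξ‖ ^ 0 * ‖𝓕 F ξ‖) ^ 2))).congr fun j => ?_
    rw [← Real.rpow_natCast (2 ^ (-s)), ← Real.rpow_mul (by norm_num)]
    push_cast
    ring_nf

lemma integral_norm_le_of_support (G : 𝓢(Ell n, ℂ)) {r : ℝ}
    (hG : ∀ ξ, G ξ ≠ 0 → ‖ξ‖ ≤ r) :
    ∫ ξ, ‖G ξ‖ ≤ √(volume.real (Metric.closedBall (0 : Ell n) r)) * sL2 G := by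
  set B := Metric.closedBall (0 : Ell n) r
  have : IsFiniteMeasure ((volume : Measure (Ell n)).restrict B) :=
    ⟨by simpa using measure_closedBall_lt_top⟩
  have h1 : ∫ ξ in B, ‖G ξ‖ = ∫ ξ, ‖G ξ‖ := by
    refine setIntegral_eq_integral_of_forall_compl_eq_zero fun ξ hξ => ?_
    by_contra h
    exact hξ (by simpa [B] using hG ξ (by simpa using h))
  have h2 := integral_mul_le_Lp_mul_Lq_of_nonneg (μ := volume.restrict B)
    Real.HolderConjugate.two_two (f := fun _ : Ell n => (1 : ℝ)) (g := fun ξ => ‖G ξ‖)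
    (Eventually.of_forall fun _ => by simp) (Eventually.of_forall fun _ => by simp)
    (memLp_const _) (by simpa using ((G.memLp 2).norm.restrict B))
  rw [← h1]
  simp only [one_mul, ← Real.sqrt_eq_rpow, Real.rpow_two] at h2
  refine h2.trans ?_
  gcongr
  · simp [Measure.real]
  · refine Real.sqrt_le_sqrt (setIntegral_le_integral (integrable_norm_sq G)
      (Eventually.of_forall fun _ => by positivity))

/-- The **Bernstein inequality** for dyadic blocks. -/
lemma norm_block_le (hφ : LPFunction φ) (j : ℤ) (F : 𝓢(Ell n, ℂ)) (x : Ell n) :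
    ‖block φ j F x‖ ≤ √((8 / 3) ^ n * volume.real (Metric.ball (0 : Ell n) 1)) *
      (2 : ℝ) ^ ((j : ℝ) * (n / 2)) * sL2 (block φ j F) := by
  have h0 : ‖block φ j F x‖ ≤ ∫ ξ, ‖𝓕 (block φ j F) ξ‖ := by
    have hinv : block φ j F = 𝓕⁻ (𝓕 (block φ j F)) :=
      (FourierTransform.fourierInv_fourier_eq _).symm
    rw [show block φ j F x = (𝓕⁻ (𝓕 (block φ j F))) x by rw [← hinv], fourierInv_coe,
      Real.fourierInv_eq]
    refine (norm_integral_le_integral_norm _).trans_eq ?_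
    simp
  have h1 := integral_norm_le_of_support (𝓕 (block φ j F)) (r := 8 / 3 * (2 : ℝ) ^ j)
    fun ξ hξ => (norm_bounds_of_blockSymbol_ne_zero hφ
      (left_ne_zero_of_mul (by rwa [fourier_block hφ] at hξ))).2
  have h2 : sL2 (𝓕 (block φ j F)) = sL2 (block φ j F) := by
    rw [sL2, integral_norm_sq_fourier, sL2]
  refine h0.trans (h1.trans_eq ?_)
  rw [h2, Measure.addHaar_real_closedBall _ _ (by positivity), finrank_euclideanSpace_fin,
    mul_pow, mul_right_comm, Real.sqrt_mul (by positivity)]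
  congr 2
  rw [Real.sqrt_eq_rpow, ← Real.rpow_natCast (2 ^ j), ← Real.rpow_mul (by positivity),
    ← Real.rpow_intCast, ← Real.rpow_mul (by norm_num)]
  ring_nf

lemma pd_coe (i : Fin n) (F : 𝓢(Ell n, ℂ)) : pd i F = LineDeriv.lineDerivOp (eVec n i) F := by
  ext x
  rw [lineDerivOp_apply_eq_fderiv]
  rfl

lemma integrable_norm_sq_pd (i : Fin n) (F : 𝓢(Ell n, ℂ)) :
    Integrable fun x => ‖pd i F x‖ ^ 2 := by
  rw [pd_coe]
  exact integrable_norm_sq _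

lemma integral_norm_sq_pd_block_block_le (hφ : LPFunction φ) (i : Fin n) (j k : ℤ)
    (F : 𝓢(Ell n, ℂ)) :
    ∫ x, ‖pd i (block φ k (block φ j F)) x‖ ^ 2 ≤
      (2 * π * (8 / 3) * (2 : ℝ) ^ k * sL2 (block φ k F)) ^ 2 := by
  rw [pd_coe, ← integral_norm_sq_fourier, mul_pow, sL2_sq,
    ← integral_norm_sq_fourier (block φ k F), ← integral_const_mul]
  refine integral_mono (integrable_norm_sq _) ((integrable_norm_sq _).const_mul _) fun ξ => ?_
  have hin : (inner ℝ · (eVec n i) : Ell n → ℝ).HasTemperateGrowth := by fun_prop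
  simp only [fourier_lineDerivOp_eq, smul_apply, smulLeftCLM_apply_apply hin,
    fourier_block hφ]
  by_cases h : blockSymbol φ k ξ = 0
  · simp [h]
  have h1 : |inner ℝ ξ (eVec n i)| ≤ 8 / 3 * (2 : ℝ) ^ k := by
    refine (abs_real_inner_le_norm _ _).trans ?_
    simpa [eVec] using (norm_bounds_of_blockSymbol_ne_zero hφ h).2
  rw [← mul_pow]
  gcongr
  simp only [norm_smul, norm_mul, Complex.norm_real, Complex.norm_I, Real.norm_eq_abs,
    abs_of_pos Real.pi_pos, Complex.norm_ofNat, mul_one]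
  calc 2 * π * (|inner ℝ ξ (eVec n i)| *
        (‖blockSymbol φ k ξ‖ * (‖blockSymbol φ j ξ‖ * ‖𝓕 F ξ‖)))
      ≤ 2 * π * ((8 / 3 * (2 : ℝ) ^ k) * (‖blockSymbol φ k ξ‖ * (1 * ‖𝓕 F ξ‖))) := by
        gcongr
        exact norm_blockSymbol_le_one hφ j ξ
    _ = _ := by ring

lemma norm_SJ_succ_sub_le (φ : Ell n → ℝ) (m : ℤ) (f : Ell n → ℂ) (x : Ell n) :
    ‖SJ φ (m + 1) f x - SJ φ m f x‖ ≤ ‖DeltaJ φ m f x‖ := by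
  set a : ℤ → ℂ := fun j => if j ≤ m - 1 then DeltaJ φ j f x else 0
  set b : ℤ → ℂ := fun j => if j = m then DeltaJ φ m f x else 0
  have hb : HasSum b (DeltaJ φ m f x) := hasSum_ite_eq m _
  have hab : (fun j : ℤ => if j ≤ m + 1 - 1 then DeltaJ φ j f x else 0) = a + b := by
    ext j
    rcases lt_trichotomy j m with h | h | h
    · simp [a, b, h.ne, h.le, h]
    · simp [a, b, h]
    · simp [a, b, h.ne', not_le.2 h, not_lt.2 h.le]
  change ‖(∑' j : ℤ, if j ≤ m + 1 - 1 then DeltaJ φ j f x else 0) - ∑' j, a j‖ ≤ _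
  rw [hab]
  by_cases ha : Summable a
  · rw [show ∑' j, (a + b) j = _ from (ha.hasSum.add hb).tsum_eq, add_sub_cancel_left]
  · have : ¬ Summable (a + b) := fun h => ha (by simpa using h.sub hb.summable)
    rw [tsum_eq_zero_of_not_summable ha, tsum_eq_zero_of_not_summable this]
    simp

lemma DeltaL2_nonneg (φ : Ell n → ℝ) (j : ℤ) (u : Fin n → Ell n → ℝ) : 0 ≤ DeltaL2 φ j u :=
  Real.sqrt_nonneg _

lemma DeltaL2_eq (hφ : LPFunction φ) (j : ℤ) (u : Fin n → 𝓢(Ell n, ℝ)) :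
    DeltaL2 φ j (fun l x => u l x) = √(∑ l, sL2 (block φ j (toComplex (u l))) ^ 2) := by
  simp only [sL2_sq, ← DeltaJ_coe hφ, coe_toComplex]
  rfl

lemma sL2_block_le_DeltaL2 (hφ : LPFunction φ) (j : ℤ) (u : Fin n → 𝓢(Ell n, ℝ)) (l : Fin n) :
    sL2 (block φ j (toComplex (u l))) ≤ DeltaL2 φ j (fun l x => u l x) := by
  rw [DeltaL2_eq hφ]
  refine Real.le_sqrt_of_sq_le ?_
  exact Finset.single_le_sum (f := fun l => sL2 (block φ j (toComplex (u l))) ^ 2)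
    (fun _ _ => by positivity) (Finset.mem_univ l)

lemma DeltaL2_le_sum (hφ : LPFunction φ) (j : ℤ) (u : Fin n → 𝓢(Ell n, ℝ)) :
    DeltaL2 φ j (fun l x => u l x) ≤ ∑ l, sL2 (block φ j (toComplex (u l))) := by
  rw [DeltaL2_eq hφ]
  have h0 : 0 ≤ ∑ l, sL2 (block φ j (toComplex (u l))) :=
    Finset.sum_nonneg fun _ _ => sL2_nonneg _
  refine Real.sqrt_le_iff.2 ⟨h0, ?_⟩
  exact Finset.sum_sq_le_sq_sum_of_nonneg fun _ _ => sL2_nonneg _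

lemma summable_Bnorm (hφ : LPFunction φ) {s : ℝ} (hs : 0 < s) (u : Fin n → 𝓢(Ell n, ℝ)) :
    Summable fun j : ℤ => (2 : ℝ) ^ ((j : ℝ) * s) * DeltaL2 φ j (fun l x => u l x) := by
  refine Summable.of_nonneg_of_le
    (fun j => mul_nonneg (by positivity) (DeltaL2_nonneg _ _ _))
    (fun j => mul_le_mul_of_nonneg_left (DeltaL2_le_sum hφ j u) (by positivity)) ?_
  simp only [Finset.mul_sum]
  exact summable_sum fun l _ => summable_rpow_mul_sL2_block hφ hs (toComplex (u l))

/-- The sum over `j` reduces to the two neighbours `j = k ± 1` of `k`. -/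
lemma norm_tsum_advection_le (hφ : LPFunction φ) (u : Fin n → 𝓢(Ell n, ℝ)) (k : ℤ) (l : Fin n)
    (x : Ell n) :
    ‖∑' j : ℤ, ∑ i, (SJ φ (j - 1) (cf (u i)) x - SJ φ (k - 1) (cf (u i)) x)
        * pd i (DeltaJ φ k (DeltaJ φ j (cf (u l)))) x‖ ≤
      ∑ i, (‖block φ (k - 2) (toComplex (u i)) x‖
          * ‖pd i (block φ k (block φ (k - 1) (toComplex (u l)))) x‖
        + ‖block φ (k - 1) (toComplex (u i)) x‖
          * ‖pd i (block φ k (block φ (k + 1) (toComplex (u l)))) x‖) := by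
  simp only [← coe_toComplex, DeltaJ_coe hφ]
  rw [tsum_eq_sum (s := {k - 1, k + 1}), Finset.sum_pair (by omega), ← Finset.sum_add_distrib]
  · refine (norm_sum_le _ _).trans (Finset.sum_le_sum fun i _ => (norm_add_le _ _).trans ?_)
    rw [norm_mul, norm_mul]
    gcongr
    · rw [norm_sub_rev, ← DeltaJ_coe hφ]
      have := norm_SJ_succ_sub_le φ (k - 2) (toComplex (u i)) x
      rwa [show k - 2 + 1 = k - 1 by ring, show SJ φ (k - 2) = SJ φ (k - 1 - 1) by ring_nf]
        at this
    · rw [← DeltaJ_coe hφ]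
      have := norm_SJ_succ_sub_le φ (k - 1) (toComplex (u i)) x
      rwa [show k - 1 + 1 = k + 1 - 1 by ring] at this
  · intro j hj
    simp only [Finset.mem_insert, Finset.mem_singleton, not_or] at hj
    refine Finset.sum_eq_zero fun i _ => ?_
    by_cases hjk : j = k
    · simp [hjk]
    · rw [block_block_eq_zero hφ (by rw [le_abs]; omega)]
      rw [pd_coe, lineDerivOp_apply_eq_fderiv]
      simp

/-- An `L²` bound for a finite sum of functions dominated by multiples of functions in `L²`. -/
lemma sqrt_integral_norm_sq_le_of_le_sum {α ι : Type*} [MeasurableSpace α] {μ : Measure α}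
    (s : Finset ι) {f : α → ℂ} {g : ι → α → ℂ} {M R : ℝ} (hM : 0 ≤ M) (hR : 0 ≤ R)
    (hg : ∀ i ∈ s, Integrable (fun x => ‖g i x‖ ^ 2) μ)
    (hgR : ∀ i ∈ s, ∫ x, ‖g i x‖ ^ 2 ∂μ ≤ R ^ 2)
    (hf : ∀ x, ‖f x‖ ≤ M * ∑ i ∈ s, ‖g i x‖) :
    √(∫ x, ‖f x‖ ^ 2 ∂μ) ≤ s.card * (M * R) := by
  refine Real.sqrt_le_iff.2 ⟨by positivity, ?_⟩
  calc ∫ x, ‖f x‖ ^ 2 ∂μ ≤ ∫ x, M ^ 2 * s.card * ∑ i ∈ s, ‖g i x‖ ^ 2 ∂μ := by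
        refine integral_mono_of_nonneg (Eventually.of_forall fun x => by positivity)
          ((integrable_finsetSum s hg).const_mul _) (Eventually.of_forall fun x => ?_)
        calc ‖f x‖ ^ 2 ≤ (M * ∑ i ∈ s, ‖g i x‖) ^ 2 := by gcongr; exact hf x
          _ = M ^ 2 * (∑ i ∈ s, ‖g i x‖) ^ 2 := by ring
          _ ≤ M ^ 2 * (s.card * ∑ i ∈ s, ‖g i x‖ ^ 2) := by
            gcongr; exact sq_sum_le_card_mul_sum_sq
          _ = _ := by ring
    _ = M ^ 2 * s.card * ∑ i ∈ s, ∫ x, ‖g i x‖ ^ 2 ∂μ := by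
        rw [integral_const_mul, integral_finsetSum s hg]
    _ ≤ M ^ 2 * s.card * (s.card * R ^ 2) := by
        gcongr
        simpa using Finset.sum_le_card_nsmul s _ _ hgR
    _ = _ := by ring

lemma norm_block_le_Bnorm (hφ : LPFunction φ) (u : Fin n → 𝓢(Ell n, ℝ)) {j k : ℤ}
    (hjk : k ≤ j + 2) (i : Fin n) (x : Ell n) :
    ‖block φ j (toComplex (u i)) x‖ ≤
      √((8 / 3) ^ n * volume.real (Metric.ball (0 : Ell n) 1)) *
        (4 * ((2 : ℝ) ^ k)⁻¹ * Bnorm φ ((n : ℝ) / 2 + 1) (fun l x => u l x)) := by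
  refine (norm_block_le hφ j _ x).trans ?_
  rw [mul_assoc]
  refine mul_le_mul_of_nonneg_left ?_ (Real.sqrt_nonneg _)
  have hB : (2 : ℝ) ^ ((j : ℝ) * ((n : ℝ) / 2 + 1)) * DeltaL2 φ j (fun l x => u l x)
      ≤ Bnorm φ ((n : ℝ) / 2 + 1) (fun l x => u l x) :=
    (summable_Bnorm hφ (by positivity) u).le_tsum j
      fun _ _ => mul_nonneg (by positivity) (DeltaL2_nonneg _ _ _)
  have hk : ((2 : ℝ) ^ j)⁻¹ ≤ 4 * ((2 : ℝ) ^ k)⁻¹ := by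
    have : (2 : ℝ) ^ k ≤ 4 * 2 ^ j := by
      calc (2 : ℝ) ^ k ≤ 2 ^ (j + 2) := zpow_le_zpow_right₀ (by norm_num) hjk
        _ = 4 * 2 ^ j := by rw [zpow_add₀ (by norm_num)]; norm_num; ring
    rw [← div_eq_mul_inv, le_div_iff₀ (by positivity), inv_mul_le_iff₀ (by positivity)]
    linarith
  have hpow : (2 : ℝ) ^ ((j : ℝ) * ((n : ℝ) / 2)) =
      ((2 : ℝ) ^ j)⁻¹ * (2 : ℝ) ^ ((j : ℝ) * ((n : ℝ) / 2 + 1)) := by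
    rw [← zpow_neg, ← Real.rpow_intCast, ← Real.rpow_add (by norm_num)]
    push_cast
    ring_nf
  rw [hpow, mul_assoc]
  refine mul_le_mul hk (le_trans ?_ hB) (mul_nonneg (by positivity) (sL2_nonneg _))
    (by positivity)
  gcongr
  exact sL2_block_le_DeltaL2 hφ j u i

/-- The bound of the neighbouring-block sum by `‖u‖_{Ḃ^{n/2+1}_{2,1}} ‖Δ_k u‖_{L²}`. -/
lemma sqrt_integral_advection_le (hφ : LPFunction φ) (u : Fin n → 𝓢(Ell n, ℝ)) (k : ℤ)
    (l : Fin n) :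
    √(∫ x, ‖∑' j : ℤ, ∑ i, (SJ φ (j - 1) (cf (u i)) x - SJ φ (k - 1) (cf (u i)) x)
        * pd i (DeltaJ φ k (DeltaJ φ j (cf (u l)))) x‖ ^ 2) ≤
      (2 * n) * (√((8 / 3) ^ n * volume.real (Metric.ball (0 : Ell n) 1)) *
        (4 * (2 * π * (8 / 3)))) *
        (Bnorm φ ((n : ℝ) / 2 + 1) (fun l x => u l x) * DeltaL2 φ k (fun l x => u l x)) := by
  set C := √((8 / 3) ^ n * volume.real (Metric.ball (0 : Ell n) 1))
  set B := Bnorm φ ((n : ℝ) / 2 + 1) (fun l x => u l x)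
  set D := DeltaL2 φ k (fun l x => u l x)
  have hB : 0 ≤ B := tsum_nonneg fun _ => mul_nonneg (by positivity) (DeltaL2_nonneg _ _ _)
  have hD : 0 ≤ D := DeltaL2_nonneg _ _ _
  have hpd (i : Fin n) (j : ℤ) :
      ∫ x, ‖pd i (block φ k (block φ j (toComplex (u l)))) x‖ ^ 2 ≤
        (2 * π * (8 / 3) * (2 : ℝ) ^ k * D) ^ 2 := by
    refine (integral_norm_sq_pd_block_block_le hφ i j k _).trans ?_
    have := sL2_nonneg (block φ k (toComplex (u l)))
    gcongr
    exact sL2_block_le_DeltaL2 hφ k u l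
  have hmain := sqrt_integral_norm_sq_le_of_le_sum (μ := volume)
    (Finset.univ : Finset (Fin n × Bool))
    (f := fun x => ∑' j : ℤ, ∑ i, (SJ φ (j - 1) (cf (u i)) x - SJ φ (k - 1) (cf (u i)) x)
        * pd i (DeltaJ φ k (DeltaJ φ j (cf (u l)))) x)
    (g := fun p => pd p.1 (block φ k (block φ (bif p.2 then k - 1 else k + 1) (toComplex (u l)))))
    (M := C * (4 * ((2 : ℝ) ^ k)⁻¹ * B)) (R := 2 * π * (8 / 3) * (2 : ℝ) ^ k * D)
    (by positivity) (by positivity) (fun p _ => integrable_norm_sq_pd _ _)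
    (fun p _ => hpd _ _) fun x => by
      refine (norm_tsum_advection_le hφ u k l x).trans ?_
      simp only [Fintype.sum_prod_type, Fintype.sum_bool, Finset.mul_sum, mul_add, cond_true,
        cond_false]
      refine Finset.sum_le_sum fun i _ => ?_
      gcongr
      · exact norm_block_le_Bnorm hφ u (by omega) i x
      · exact norm_block_le_Bnorm hφ u (by omega) i x
  refine hmain.trans_eq ?_
  have : (2 : ℝ) ^ k ≠ 0 := by positivity
  simp only [Finset.card_univ, Fintype.card_prod, Fintype.card_fin, Fintype.card_bool]
  push_cast
  field_simp

end LittlewoodPaley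

/-- **Besov piece (5.2)/(t1).** For a Schwartz vector field `u`, for each `k` and
each component `l`, `‖Σ_j Σᵢ (Ṡ_{j−1}uᵢ − Ṡ_{k−1}uᵢ)∂ᵢ(Δ_kΔ_j u_l)‖_{L²}
≤ c d_k 2^{−k(n/2+1)} ‖u‖²_{Ḃ^{n/2+1}_{2,1}}` with `d_k ≥ 0`, `Σ_k d_k = 1`. -/
theorem besov_piece_t1 (n : ℕ) (hn : 1 ≤ n)
    (φ : Ell n → ℝ) (hφ : LPFunction φ) :
    ∃ c > (0 : ℝ), ∀ u : Fin n → 𝓢(Ell n, ℝ),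
      ∃ d : ℤ → ℝ, (∀ k, 0 ≤ d k) ∧ (∑' k : ℤ, d k) = 1 ∧
        ∀ k : ℤ, ∀ l : Fin n,
          Real.sqrt (∫ x, ‖∑' j : ℤ, ∑ i,
              (SJ φ (j - 1) (cf (u i)) x - SJ φ (k - 1) (cf (u i)) x)
                * pd i (DeltaJ φ k (DeltaJ φ j (cf (u l)))) x‖ ^ 2)
            ≤ c * d k * (2 : ℝ) ^ (-(k : ℝ) * ((n : ℝ) / 2 + 1))
                * Bnorm φ ((n : ℝ) / 2 + 1) (fun l' x => u l' x) ^ 2 := by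
  set C := √((8 / 3) ^ n * volume.real (Metric.ball (0 : Ell n) 1)) with hC
  have hCpos : 0 < C := Real.sqrt_pos.2 (mul_pos (by positivity)
    (ENNReal.toReal_pos (Metric.measure_ball_pos _ _ one_pos).ne' measure_ball_lt_top.ne))
  have hn' : (0 : ℝ) < n := by exact_mod_cast hn
  have hc : 0 < (2 * n) * (C * (4 * (2 * Real.pi * (8 / 3)))) := by positivity
  refine ⟨_, hc, fun u => ?_⟩
  set s : ℝ := (n : ℝ) / 2 + 1
  have hnn (j : ℤ) : 0 ≤ (2 : ℝ) ^ ((j : ℝ) * s) * DeltaL2 φ j (fun l x => u l x) :=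
    mul_nonneg (by positivity) (DeltaL2_nonneg _ _ _)
  by_cases hB : Bnorm φ s (fun l x => u l x) = 0
  · refine ⟨fun k => if k = 0 then 1 else 0, fun k => by positivity, tsum_ite_eq 0 _,
      fun k l => (sqrt_integral_advection_le hφ u k l).trans ?_⟩
    change _ * (Bnorm φ s (fun l x => u l x) * _) ≤ _
    simp [hB]
  · refine ⟨fun k => (2 : ℝ) ^ ((k : ℝ) * s) * DeltaL2 φ k (fun l x => u l x) /
      Bnorm φ s (fun l x => u l x), fun k => div_nonneg (hnn k) (tsum_nonneg hnn), ?_,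
      fun k l => (sqrt_integral_advection_le hφ u k l).trans_eq ?_⟩
    · rw [tsum_div_const]
      exact div_self hB
    · change _ * (Bnorm φ s (fun l x => u l x) * _) = _
      have h2 : (2 : ℝ) ^ (-(k : ℝ) * s) * (2 : ℝ) ^ ((k : ℝ) * s) = 1 := by
        rw [← Real.rpow_add (by norm_num)]
        simp
      rw [← hC]
      set B := Bnorm φ s (fun l x => u l x)
      set D := DeltaL2 φ k (fun l x => u l x)
      have hdiv : (2 : ℝ) ^ ((k : ℝ) * s) * D / B * B ^ 2 = (2 : ℝ) ^ ((k : ℝ) * s) * D * B := by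
        field_simp
      linear_combination (-(2 * n * (C * (4 * (2 * Real.pi * (8 / 3)))))) *
        ((2 : ℝ) ^ (-(k : ℝ) * s) * hdiv + B * D * h2)

end
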